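/- Under the sign condition b₁(r,1,θ) − 2 Re λ(r,θ) ≤ 0, there is a constant c such that for every r ∈ [r_min, r_max] and every w ∈ H, Re{−i B(r; w, w)} ≤ c ‖w‖². -/

import Mathlib

open Set MeasureTheory Complex ComplexConjugate

noncomputable section

/-- The rectangular domain `𝔇 = (0,1) × (t1,t2)`. -/
def Dom (t1 t2 : ℝ) : Set (ℝ × ℝ) := Ioo (0:ℝ) 1 ×ˢ Ioo t1 t2

/-- Partial derivative in the first variable. -/
def pd1 (u : ℝ × ℝ → ℂ) (p : ℝ × ℝ) : ℂ := fderiv ℝ u p (1, 0)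

/-- Partial derivative in the second variable. -/
def pd2 (u : ℝ × ℝ → ℂ) (p : ℝ × ℝ) : ℂ := fderiv ℝ u p (0, 1)

/-- The `L²(𝔇)` norm. -/
def L2n (t1 t2 : ℝ) (u : ℝ × ℝ → ℂ) : ℝ := Real.sqrt (∫ p in Dom t1 t2, ‖u p‖ ^ 2)

/-- The `H¹(𝔇)` norm. -/
def H1n (t1 t2 : ℝ) (u : ℝ × ℝ → ℂ) : ℝ :=
  Real.sqrt (∫ p in Dom t1 t2, ‖u p‖ ^ 2 + ‖pd1 u p‖ ^ 2 + ‖pd2 u p‖ ^ 2)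

/-- Membership in the space `H = {u ∈ H¹(𝔇) : u = 0 on ∂𝔇_D}` (within the class of
`C¹` functions on the closed rectangle). -/
def MemBH (t1 t2 : ℝ) (u : ℝ × ℝ → ℂ) : Prop :=
  ContDiffOn ℝ 1 u (closure (Dom t1 t2)) ∧ (∀ t ∈ Icc t1 t2, u (0, t) = 0) ∧
    (∀ y ∈ Icc (0:ℝ) 1, u (y, t1) = 0 ∧ u (y, t2) = 0)

/-- The sesquilinear form
`B(r;v,w) = (D∇v,∇w) - i(∫ λ v(1,θ) conj w(1,θ) dθ - (b·∇v,w)) + δ(v,w)`. -/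
def sesq (t1 t2 : ℝ) (D11 D12 D22 b1 b2 : ℝ × ℝ → ℝ) (lam : ℝ → ℂ) (δ : ℝ)
    (v w : ℝ × ℝ → ℂ) : ℂ :=
  (∫ p in Dom t1 t2,
      ((D11 p : ℂ) * pd1 v p + (D12 p : ℂ) * pd2 v p) * conj (pd1 w p)
    + ((D12 p : ℂ) * pd1 v p + (D22 p : ℂ) * pd2 v p) * conj (pd2 w p))
  - Complex.I * ((∫ t in Ioo t1 t2, lam t * v (1, t) * conj (w (1, t)))
    - ∫ p in Dom t1 t2, ((b1 p : ℂ) * pd1 v p + (b2 p : ℂ) * pd2 v p) * conj (w p))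
  + (δ : ℂ) * ∫ p in Dom t1 t2, v p * conj (w p)

end

theorem isOpen_Dom (t1 t2 : ℝ) : IsOpen (Dom t1 t2) := isOpen_Ioo.prod isOpen_Ioo

theorem closure_Dom {t1 t2 : ℝ} (ht : t1 < t2) :
    closure (Dom t1 t2) = Icc (0 : ℝ) 1 ×ˢ Icc t1 t2 := by
  rw [Dom, closure_prod_eq, closure_Ioo zero_ne_one, closure_Ioo ht.ne]

theorem isCompact_closure_Dom {t1 t2 : ℝ} (ht : t1 < t2) : IsCompact (closure (Dom t1 t2)) := by
  rw [closure_Dom ht]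
  exact isCompact_Icc.prod isCompact_Icc

theorem uniqueDiffOn_closure_Dom {t1 t2 : ℝ} (ht : t1 < t2) :
    UniqueDiffOn ℝ (closure (Dom t1 t2)) := by
  rw [closure_Dom ht]
  exact (uniqueDiffOn_Icc zero_lt_one).prod (uniqueDiffOn_Icc ht)

theorem closure_Dom_mem_nhds {t1 t2 : ℝ} {p : ℝ × ℝ} (hp : p ∈ Dom t1 t2) :
    closure (Dom t1 t2) ∈ nhds p :=
  Filter.mem_of_superset ((isOpen_Dom t1 t2).mem_nhds hp) subset_closure

theorem Dom_ae_eq_Icc (t1 t2 : ℝ) :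
    Dom t1 t2 =ᵐ[volume] Icc ((0 : ℝ), t1) (1, t2) := by
  rw [Icc_prod_eq]
  exact Measure.set_prod_ae_eq Ioo_ae_eq_Icc Ioo_ae_eq_Icc

theorem ContDiffOn.differentiableAt_of_mem_Dom {E : Type*} [NormedAddCommGroup E]
    [NormedSpace ℝ E] {t1 t2 : ℝ} {u : ℝ × ℝ → E} (hu : ContDiffOn ℝ 1 u (closure (Dom t1 t2)))
    {p : ℝ × ℝ} (hp : p ∈ Dom t1 t2) : DifferentiableAt ℝ u p :=
  (hu.contDiffAt (closure_Dom_mem_nhds hp)).differentiableAt one_ne_zero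

/-- A function that is continuous up to the boundary is integrable on the rectangle. -/
theorem integrableOn_Dom_of_continuousOn {E : Type*} [NormedAddCommGroup E]
    {t1 t2 : ℝ} (ht : t1 < t2) {f : ℝ × ℝ → E} (hf : ContinuousOn f (closure (Dom t1 t2))) :
    IntegrableOn f (Dom t1 t2) :=
  (hf.integrableOn_compact (isCompact_closure_Dom ht)).mono_set subset_closure

/-- The directional derivatives of a function that is `C¹` up to the boundary agree on the open
rectangle with functions continuous on the closed one. -/
theorem ContDiffOn.exists_continuousOn_eqOn_fderiv {E : Type*} [NormedAddCommGroup E]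
    [NormedSpace ℝ E] {t1 t2 : ℝ} (ht : t1 < t2) {u : ℝ × ℝ → E}
    (hu : ContDiffOn ℝ 1 u (closure (Dom t1 t2))) (v : ℝ × ℝ) :
    ∃ g : ℝ × ℝ → E, ContinuousOn g (closure (Dom t1 t2)) ∧
      EqOn g (fun p => fderiv ℝ u p v) (Dom t1 t2) := by
  refine ⟨fun p => fderivWithin ℝ u (closure (Dom t1 t2)) p v, ?_, fun p hp => ?_⟩
  · exact (hu.continuousOn_fderivWithin (uniqueDiffOn_closure_Dom ht) le_rfl).clm_apply
      continuousOn_const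
  · simp only [fderivWithin_of_mem_nhds (closure_Dom_mem_nhds hp)]

theorem ContDiffOn.integrableOn_Dom_fderiv {E : Type*} [NormedAddCommGroup E]
    [NormedSpace ℝ E] {t1 t2 : ℝ} (ht : t1 < t2) {u : ℝ × ℝ → E}
    (hu : ContDiffOn ℝ 1 u (closure (Dom t1 t2))) (v : ℝ × ℝ) :
    IntegrableOn (fun p => fderiv ℝ u p v) (Dom t1 t2) := by
  obtain ⟨g, hg, hgu⟩ := hu.exists_continuousOn_eqOn_fderiv ht v
  exact (integrableOn_Dom_of_continuousOn ht hg).congr_fun hgu (isOpen_Dom t1 t2).measurableSet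

/-- The divergence theorem on the rectangle for a vector field that is `C¹` up to the boundary and
vanishes on the sides where the Dirichlet condition is imposed. -/
theorem integral_divergence_Dom {t1 t2 : ℝ} (ht : t1 < t2) {f g : ℝ × ℝ → ℝ}
    (hf : ContDiffOn ℝ 1 f (closure (Dom t1 t2))) (hg : ContDiffOn ℝ 1 g (closure (Dom t1 t2)))
    (hf0 : ∀ t ∈ Icc t1 t2, f (0, t) = 0)
    (hg0 : ∀ y ∈ Icc (0 : ℝ) 1, g (y, t1) = 0 ∧ g (y, t2) = 0) :
    ∫ p in Dom t1 t2, (fderiv ℝ f p (1, 0) + fderiv ℝ g p (0, 1)) =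
      ∫ t in Ioo t1 t2, f (1, t) := by
  have hcl : closure (Dom t1 t2) = Icc ((0 : ℝ), t1) (1, t2) := by
    rw [closure_Dom ht, Icc_prod_eq]
  have hint := (hf.integrableOn_Dom_fderiv ht (1, 0)).add (hg.integrableOn_Dom_fderiv ht (0, 1))
  have key := integral_divergence_prod_Icc_of_hasFDerivAt_off_countable_of_le f g
    (fderiv ℝ f) (fderiv ℝ g) (0, t1) (1, t2) ⟨zero_le_one, ht.le⟩ ∅ countable_empty
    (hcl ▸ hf.continuousOn) (hcl ▸ hg.continuousOn)
    (fun p hp => (hf.differentiableAt_of_mem_Dom hp.1).hasFDerivAt)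
    (fun p hp => (hg.differentiableAt_of_mem_Dom hp.1).hasFDerivAt)
    ((integrableOn_congr_set_ae (Dom_ae_eq_Icc t1 t2)).1 hint)
  have hbot : ∫ x in (0 : ℝ)..1, g (x, t1) = 0 :=
    intervalIntegral.integral_zero_ae
      (.of_forall fun x hx => (hg0 x (uIcc_of_le (zero_le_one' ℝ) ▸ uIoc_subset_uIcc hx)).1)
  have htop : ∫ x in (0 : ℝ)..1, g (x, t2) = 0 :=
    intervalIntegral.integral_zero_ae
      (.of_forall fun x hx => (hg0 x (uIcc_of_le (zero_le_one' ℝ) ▸ uIoc_subset_uIcc hx)).2)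
  have hleft : ∫ t in t1..t2, f (0, t) = 0 :=
    intervalIntegral.integral_zero_ae
      (.of_forall fun t ht' => hf0 t (uIcc_of_le ht.le ▸ uIoc_subset_uIcc ht'))
  rw [setIntegral_congr_set (Dom_ae_eq_Icc t1 t2), key, hbot, htop, hleft,
    intervalIntegral.integral_of_le ht.le, integral_Ioc_eq_integral_Ioo]
  ring

theorem fderiv_mul_norm_sq_apply {b : ℝ × ℝ → ℝ} {w : ℝ × ℝ → ℂ} {p : ℝ × ℝ}
    (hb : DifferentiableAt ℝ b p) (hw : DifferentiableAt ℝ w p) (v : ℝ × ℝ) :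
    fderiv ℝ (fun q => b q * ‖w q‖ ^ 2) p v =
      fderiv ℝ b p v * ‖w p‖ ^ 2 + 2 * ((b p : ℂ) * fderiv ℝ w p v * conj (w p)).re := by
  have h : HasFDerivAt (fun q => b q * ‖w q‖ ^ 2) _ p :=
    hb.hasFDerivAt.mul hw.hasFDerivAt.norm_sq
  rw [h.fderiv]
  simp [Complex.inner, Complex.mul_re, Complex.mul_im]
  ring

theorem fderiv_ofReal_apply {b : ℝ × ℝ → ℝ} {p : ℝ × ℝ} (hb : DifferentiableAt ℝ b p)
    (v : ℝ × ℝ) : fderiv ℝ (fun q => (b q : ℂ)) p v = (fderiv ℝ b p v : ℂ) := by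
  have h : HasFDerivAt (fun q => (b q : ℂ)) _ p :=
    Complex.ofRealCLM.hasFDerivAt.comp p hb.hasFDerivAt
  rw [h.fderiv]
  simp

/-- Integration by parts bounds the real part of the drift term `(b·∇w, w)`. -/
theorem re_integral_drift_le {t1 t2 : ℝ} (ht : t1 < t2) {b1 b2 : ℝ × ℝ → ℝ} {w : ℝ × ℝ → ℂ}
    (hb1 : ContDiffOn ℝ 1 b1 (closure (Dom t1 t2)))
    (hb2 : ContDiffOn ℝ 1 b2 (closure (Dom t1 t2))) (hw : MemBH t1 t2 w) {M : ℝ}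
    (hM : ∀ p ∈ Dom t1 t2, ‖pd1 (fun q => (b1 q : ℂ)) p + pd2 (fun q => (b2 q : ℂ)) p‖ ≤ M) :
    (∫ p in Dom t1 t2, ((b1 p : ℂ) * pd1 w p + (b2 p : ℂ) * pd2 w p) * conj (w p)).re ≤
      1 / 2 * (∫ t in Ioo t1 t2, b1 (1, t) * ‖w (1, t)‖ ^ 2) +
        M / 2 * ∫ p in Dom t1 t2, ‖w p‖ ^ 2 := by
  obtain ⟨hwc, hw0, hw12⟩ := hw
  have hmeas := (isOpen_Dom t1 t2).measurableSet
  have hF1 : ContDiffOn ℝ 1 (fun q => b1 q * ‖w q‖ ^ 2) (closure (Dom t1 t2)) :=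
    hb1.mul (hwc.norm_sq ℝ)
  have hF2 : ContDiffOn ℝ 1 (fun q => b2 q * ‖w q‖ ^ 2) (closure (Dom t1 t2)) :=
    hb2.mul (hwc.norm_sq ℝ)
  have hdiv := integral_divergence_Dom ht hF1 hF2 (fun t ht' => by simp [hw0 t ht'])
    (fun y hy => by simp [hw12 y hy])
  have hdint : IntegrableOn (fun p => fderiv ℝ (fun q => b1 q * ‖w q‖ ^ 2) p (1, 0) +
      fderiv ℝ (fun q => b2 q * ‖w q‖ ^ 2) p (0, 1)) (Dom t1 t2) := (hF1.integrableOn_Dom_fderiv ht (1, 0)).add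
    (hF2.integrableOn_Dom_fderiv ht (0, 1))
  have hwint : IntegrableOn (fun p => ‖w p‖ ^ 2) (Dom t1 t2) :=
    integrableOn_Dom_of_continuousOn ht (hwc.continuousOn.norm.pow 2)
  have hint : IntegrableOn
      (fun p => ((b1 p : ℂ) * pd1 w p + (b2 p : ℂ) * pd2 w p) * conj (w p)) (Dom t1 t2) := by
    obtain ⟨g1, hg1, hgw1⟩ := hwc.exists_continuousOn_eqOn_fderiv ht (1, 0)
    obtain ⟨g2, hg2, hgw2⟩ := hwc.exists_continuousOn_eqOn_fderiv ht (0, 1)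
    have hcont : ContinuousOn
        (fun p => ((b1 p : ℂ) * g1 p + (b2 p : ℂ) * g2 p) * conj (w p)) (closure (Dom t1 t2)) :=
      (((Complex.continuous_ofReal.comp_continuousOn hb1.continuousOn).mul hg1).add
        ((Complex.continuous_ofReal.comp_continuousOn hb2.continuousOn).mul hg2)).mul
        (Complex.continuous_conj.comp_continuousOn hwc.continuousOn)
    refine (integrableOn_Dom_of_continuousOn ht hcont).congr_fun (fun p hp => ?_) hmeas
    simp only [pd1, pd2, hgw1 hp, hgw2 hp]
  have hre := Complex.reCLM.integral_comp_comm hint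
  simp only [Complex.reCLM_apply] at hre
  rw [← hre, ← hdiv, ← integral_const_mul, ← integral_const_mul,
    ← integral_add (hdint.const_mul _) (hwint.const_mul _)]
  refine setIntegral_mono_on hint.re ((hdint.const_mul _).add (hwint.const_mul _)) hmeas
    fun p hp => ?_
  have hdb1 := hb1.differentiableAt_of_mem_Dom hp
  have hdb2 := hb2.differentiableAt_of_mem_Dom hp
  have hdw := hwc.differentiableAt_of_mem_Dom hp
  have hMp := hM p hp
  rw [pd1, pd2, fderiv_ofReal_apply hdb1, fderiv_ofReal_apply hdb2, ← Complex.ofReal_add,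
    Complex.norm_real, Real.norm_eq_abs] at hMp
  have hdivb := mul_le_mul_of_nonneg_right (abs_le.1 hMp).1 (sq_nonneg ‖w p‖)
  simp only [fderiv_mul_norm_sq_apply hdb1 hdw, fderiv_mul_norm_sq_apply hdb2 hdw,
    pd1, pd2, add_mul, Complex.add_re]
  linarith

theorem im_integral_diffusion_eq_zero (t1 t2 : ℝ) (D11 D12 D22 : ℝ × ℝ → ℝ) (w : ℝ × ℝ → ℂ) :
    (∫ p in Dom t1 t2,
        ((D11 p : ℂ) * pd1 w p + (D12 p : ℂ) * pd2 w p) * conj (pd1 w p)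
      + ((D12 p : ℂ) * pd1 w p + (D22 p : ℂ) * pd2 w p) * conj (pd2 w p)).im = 0 := by
  rw [← Complex.conj_eq_iff_im, ← integral_conj]
  congr 1 with p
  simp only [map_add, map_mul, Complex.conj_ofReal, Complex.conj_conj]
  ring

theorem im_integral_mul_conj_self (t1 t2 : ℝ) (w : ℝ × ℝ → ℂ) :
    (∫ p in Dom t1 t2, w p * conj (w p)).im = 0 := by
  rw [← Complex.conj_eq_iff_im, ← integral_conj]
  congr 1 with p
  simp only [map_mul, Complex.conj_conj]
  ring

/-- Under the sign condition `b₁(r,1,θ) − 2 Re λ(r,θ) ≤ 0` there is a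
constant `c` such that for every `r ∈ [rmin, rmax]` and every `w ∈ H`,
`Re{−i B(r; w, w)} ≤ c ‖w‖²`. -/
theorem re_neg_I_mul_sesq_le
    (t1 t2 rmin rmax : ℝ) (ht : t1 < t2) (hr : rmin ≤ rmax)
    (D11 D12 D22 b1 b2 : ℝ → ℝ × ℝ → ℝ) (lam : ℝ → ℝ → ℂ) (δ : ℝ) (hδ : 0 < δ)
    -- regularity of the coefficients: `D` continuous, `b` of class `C¹`, `λ` continuous
    (hD : ∀ r ∈ Icc rmin rmax, ContinuousOn (D11 r) (closure (Dom t1 t2)) ∧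
      ContinuousOn (D12 r) (closure (Dom t1 t2)) ∧ ContinuousOn (D22 r) (closure (Dom t1 t2)))
    (hb : ∀ r ∈ Icc rmin rmax, ContDiffOn ℝ 1 (b1 r) (closure (Dom t1 t2)) ∧
      ContDiffOn ℝ 1 (b2 r) (closure (Dom t1 t2)))
    (hlamc : ∀ r ∈ Icc rmin rmax, ContinuousOn (lam r) (Icc t1 t2))
    -- `div b = b₁_y + b₂_θ` is uniformly bounded
    (Mb : ℝ) (hMb : ∀ r ∈ Icc rmin rmax, ∀ p ∈ closure (Dom t1 t2),
      ‖pd1 (fun q => ((b1 r q : ℂ))) p + pd2 (fun q => ((b2 r q : ℂ))) p‖ ≤ Mb)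
    -- the sign condition `b₁(r,1,θ) − 2 Re λ(r,θ) ≤ 0`
    (hsign : ∀ r ∈ Icc rmin rmax, ∀ t ∈ Icc t1 t2, b1 r (1, t) - 2 * (lam r t).re ≤ 0) :
    ∃ c : ℝ, ∀ r ∈ Icc rmin rmax, ∀ w : ℝ × ℝ → ℂ, MemBH t1 t2 w →
      (-Complex.I * sesq t1 t2 (D11 r) (D12 r) (D22 r) (b1 r) (b2 r) (lam r) δ w w).re ≤
        c * L2n t1 t2 w ^ 2 := by
  refine ⟨Mb / 2, fun r hr' w hw => ?_⟩
  have hdrift := re_integral_drift_le ht (hb r hr').1 (hb r hr').2 hw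
    fun p hp => hMb r hr' p (subset_closure hp)
  have hslice : MapsTo (fun t : ℝ => ((1 : ℝ), t)) (Icc t1 t2) (closure (Dom t1 t2)) := by
    intro t ht'
    rw [closure_Dom ht]
    exact ⟨right_mem_Icc.2 zero_le_one, ht'⟩
  have hslicec : ContinuousOn (fun t : ℝ => ((1 : ℝ), t)) (Icc t1 t2) := by fun_prop
  have hw1 : ContinuousOn (fun t => w (1, t)) (Icc t1 t2) :=
    hw.1.continuousOn.comp hslicec hslice
  have hb11 : ContinuousOn (fun t => b1 r (1, t)) (Icc t1 t2) :=
    (hb r hr').1.continuousOn.comp hslicec hslice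
  have hlint : IntegrableOn (fun t => lam r t * w (1, t) * conj (w (1, t))) (Ioo t1 t2) :=
    ((((hlamc r hr').mul hw1).mul
      (Complex.continuous_conj.comp_continuousOn hw1)).integrableOn_Icc).mono_set Ioo_subset_Icc_self
  have hbint : IntegrableOn (fun t => b1 r (1, t) * ‖w (1, t)‖ ^ 2) (Ioo t1 t2) :=
    ((hb11.mul (hw1.norm.pow 2)).integrableOn_Icc).mono_set Ioo_subset_Icc_self
  have hbdry : 1 / 2 * (∫ t in Ioo t1 t2, b1 r (1, t) * ‖w (1, t)‖ ^ 2) ≤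
      (∫ t in Ioo t1 t2, lam r t * w (1, t) * conj (w (1, t))).re := by
    have hre := Complex.reCLM.integral_comp_comm hlint
    simp only [Complex.reCLM_apply] at hre
    rw [← hre, ← integral_const_mul]
    refine setIntegral_mono_on (hbint.const_mul _) hlint.re measurableSet_Ioo fun t ht' => ?_
    have hs := mul_nonpos_of_nonpos_of_nonneg (hsign r hr' t (Ioo_subset_Icc_self ht'))
      (sq_nonneg ‖w (1, t)‖)
    rw [mul_assoc, Complex.mul_conj, Complex.re_mul_ofReal, Complex.normSq_eq_norm_sq]
    linarith
  have hL2 : L2n t1 t2 w ^ 2 = ∫ p in Dom t1 t2, ‖w p‖ ^ 2 :=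
    Real.sq_sqrt (integral_nonneg fun p => sq_nonneg _)
  have hD0 := im_integral_diffusion_eq_zero t1 t2 (D11 r) (D12 r) (D22 r) w
  have hm0 := im_integral_mul_conj_self t1 t2 w
  rw [hL2, sesq]
  simp only [Complex.mul_re, Complex.neg_re, Complex.neg_im, Complex.I_re, Complex.I_im,
    Complex.add_im, Complex.sub_im, Complex.mul_im, Complex.sub_re, Complex.ofReal_re,
    Complex.ofReal_im, hD0, hm0]
  linarith
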